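/- Let n, L ∈ ℕ, let A₀ be an n×n Hermitian matrix over ℂ, and let u₁, …, u_L be n×n positive semidefinite Hermitian matrices satisfying the covering condition ∑_{m=1}^{L} u_m ≥ 1 (i.e., ∑_m u_m − I is positive semidefinite). Let μ be a probability measure on ℝ with compact support, and let ω = (ω₁, …, ω_L) be distributed according to the product measure ⊗_{m=1}^{L} μ. Define the random Hermitian matrix H(ω) := A₀ + ∑_{m=1}^{L} ω_m u_m. Then for every λ ∈ ℝ and every ε > 0, 𝔼[ #{i : λ_i(H(ω)) ∈ [λ−ε, λ+ε]} ] ≤ s(μ, 4ε) · ∑_{m=1}^{L} rank(u_m), where the eigenvalues λ_i(H(ω)) are counted with multiplicity and s(μ, δ) := sup_{t∈ℝ} μ([t−δ, t+δ]). -/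

import Mathlib

open MeasureTheory
open scoped ComplexOrder

/-- The modulus of continuity `s(μ, δ) = sup_t μ([t-δ, t+δ])` of a measure `μ` on `ℝ`. -/
noncomputable def modulusOfContinuity (μ : Measure ℝ) (ε : ℝ) : ℝ :=
  ⨆ l : ℝ, (μ (Set.Icc (l - ε) (l + ε))).toReal

/-- The alloy-type matrix `H(ω) = A₀ + ∑ₘ ωₘ uₘ` is Hermitian for Hermitian `A₀`, `uₘ`
and real coupling constants `ωₘ`. -/
theorem isHermitian_alloy {n L : ℕ} {A₀ : Matrix (Fin n) (Fin n) ℂ}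
    {u : Fin L → Matrix (Fin n) (Fin n) ℂ} (hA₀ : A₀.IsHermitian)
    (hu : ∀ m, (u m).IsHermitian) (ω : Fin L → ℝ) :
    (A₀ + ∑ m, ω m • u m).IsHermitian := by
  refine hA₀.add ?_
  unfold Matrix.IsHermitian
  rw [Matrix.conjTranspose_sum]
  exact Finset.sum_congr rfl fun m _ => IsSelfAdjoint.smul (star_trivial (ω m)) (hu m)

/-- The real quadratic form `v ↦ Re ⟨v, A v⟩` of a complex matrix. -/
noncomputable def reQuadForm {ι : Type*} [Fintype ι] [DecidableEq ι] (A : Matrix ι ι ℂ)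
    (v : EuclideanSpace ℂ ι) : ℝ :=
  (inner ℂ v (Matrix.toEuclideanLin A v)).re

section QuadraticForm

variable {ι : Type*} [Fintype ι] [DecidableEq ι]

lemma reQuadForm_add (A B : Matrix ι ι ℂ) (v : EuclideanSpace ℂ ι) :
    reQuadForm (A + B) v = reQuadForm A v + reQuadForm B v := by
  simp only [reQuadForm, map_add, LinearMap.add_apply, inner_add_right, Complex.add_re]

lemma reQuadForm_sub (A B : Matrix ι ι ℂ) (v : EuclideanSpace ℂ ι) :
    reQuadForm (A - B) v = reQuadForm A v - reQuadForm B v := by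
  simp only [reQuadForm, map_sub, LinearMap.sub_apply, inner_sub_right, Complex.sub_re]

lemma reQuadForm_smul (r : ℝ) (A : Matrix ι ι ℂ) (v : EuclideanSpace ℂ ι) :
    reQuadForm (r • A) v = r * reQuadForm A v := by
  have h : r • A = (r : ℂ) • A := by ext; simp
  simp only [reQuadForm, h, map_smul, LinearMap.smul_apply, inner_smul_right, Complex.re_ofReal_mul]

lemma reQuadForm_one (v : EuclideanSpace ℂ ι) : reQuadForm 1 v = ‖v‖ ^ 2 := by
  have h : Matrix.toEuclideanLin (1 : Matrix ι ι ℂ) v = v := by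
    ext; simp
  rw [reQuadForm, h]
  exact inner_self_eq_norm_sq (𝕜 := ℂ) v

lemma reQuadForm_sum {κ : Type*} (s : Finset κ) (A : κ → Matrix ι ι ℂ)
    (v : EuclideanSpace ℂ ι) :
    reQuadForm (∑ k ∈ s, A k) v = ∑ k ∈ s, reQuadForm (A k) v := by
  simp only [reQuadForm, map_sum, LinearMap.sum_apply, inner_sum, Complex.re_sum]

lemma Matrix.PosSemidef.reQuadForm_nonneg {A : Matrix ι ι ℂ} (hA : A.PosSemidef)
    (v : EuclideanSpace ℂ ι) : 0 ≤ reQuadForm A v :=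
  (Matrix.isPositive_toEuclideanLin_iff.mpr hA).re_inner_nonneg_right v

lemma abs_reQuadForm_le (A : Matrix ι ι ℂ) (v : EuclideanSpace ℂ ι) :
    |reQuadForm A v| ≤ ‖Matrix.toEuclideanCLM (n := ι) (𝕜 := ℂ) A‖ * ‖v‖ ^ 2 :=
  calc |reQuadForm A v| ≤ ‖v‖ * ‖Matrix.toEuclideanCLM (n := ι) (𝕜 := ℂ) A v‖ :=
        (Complex.abs_re_le_norm _).trans (norm_inner_le_norm _ _)
    _ ≤ ‖v‖ * (‖Matrix.toEuclideanCLM (n := ι) (𝕜 := ℂ) A‖ * ‖v‖) := by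
        gcongr; exact ContinuousLinearMap.le_opNorm _ _
    _ = _ := by ring

variable {A B : Matrix ι ι ℂ}

lemma reQuadForm_eq_sum (hA : A.IsHermitian) (v : EuclideanSpace ℂ ι) :
    reQuadForm A v = ∑ i, hA.eigenvalues i * ‖hA.eigenvectorBasis.repr v i‖ ^ 2 := by
  have hb (i : ι) : Matrix.toEuclideanLin A (hA.eigenvectorBasis i) =
      (hA.eigenvalues i : ℂ) • hA.eigenvectorBasis i := by
    ext j
    have := congrFun (hA.mulVec_eigenvectorBasis i) j
    simpa using! this
  have hv : Matrix.toEuclideanLin A v =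
      ∑ i, hA.eigenvectorBasis.repr v i • (hA.eigenvalues i : ℂ) • hA.eigenvectorBasis i := by
    conv_lhs => rw [← hA.eigenvectorBasis.sum_repr v]
    simp only [map_sum, map_smul, hb]
  rw [reQuadForm, hv, inner_sum, Complex.re_sum]
  refine Finset.sum_congr rfl fun i _ => ?_
  rw [inner_smul_right, inner_smul_right, ← inner_conj_symm, ← hA.eigenvectorBasis.repr_apply_apply,
    mul_left_comm, Complex.mul_conj, ← Complex.ofReal_mul, Complex.ofReal_re,
    Complex.normSq_eq_norm_sq]

lemma norm_sq_eq_sum_eigenvectorBasis (hA : A.IsHermitian) (v : EuclideanSpace ℂ ι) :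
    ‖v‖ ^ 2 = ∑ i, ‖hA.eigenvectorBasis.repr v i‖ ^ 2 := by
  rw [← hA.eigenvectorBasis.repr.norm_map v, EuclideanSpace.norm_sq_eq]

/-- The span of the eigenvectors of `A` with index in `s`. -/
noncomputable def eigenSpan (hA : A.IsHermitian) (s : Finset ι) :
    Submodule ℂ (EuclideanSpace ℂ ι) :=
  Submodule.span ℂ (hA.eigenvectorBasis '' s)

lemma finrank_eigenSpan (hA : A.IsHermitian) (s : Finset ι) :
    Module.finrank ℂ (eigenSpan hA s) = s.card := by
  have h := hA.eigenvectorBasis.orthonormal.linearIndependent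
  rw [eigenSpan, ← Finset.coe_image, finrank_span_finset_eq_card,
    Finset.card_image_of_injective _ h.injective]
  rw [Finset.coe_image]
  exact h.linearIndepOn_id.mono (Set.image_subset_range _ _)

lemma repr_eq_zero_of_mem_eigenSpan (hA : A.IsHermitian) {s : Finset ι}
    {v : EuclideanSpace ℂ ι} (hv : v ∈ eigenSpan hA s) {i : ι} (hi : i ∉ s) :
    hA.eigenvectorBasis.repr v i = 0 := by
  rw [eigenSpan, ← OrthonormalBasis.coe_toBasis, Module.Basis.mem_span_image] at hv
  by_contra h
  exact hi (hv (by simpa using h))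

lemma mul_norm_sq_le_reQuadForm (hA : A.IsHermitian) {s : Finset ι} {t : ℝ}
    (hs : ∀ i ∈ s, t ≤ hA.eigenvalues i) {v : EuclideanSpace ℂ ι} (hv : v ∈ eigenSpan hA s) :
    t * ‖v‖ ^ 2 ≤ reQuadForm A v := by
  rw [reQuadForm_eq_sum hA, norm_sq_eq_sum_eigenvectorBasis hA, Finset.mul_sum]
  refine Finset.sum_le_sum fun i _ => ?_
  by_cases hi : i ∈ s
  · gcongr; exact hs i hi
  · simp [repr_eq_zero_of_mem_eigenSpan hA hv hi]

lemma reQuadForm_le_mul_norm_sq (hA : A.IsHermitian) {s : Finset ι} {t : ℝ}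
    (hs : ∀ i ∈ s, hA.eigenvalues i ≤ t) {v : EuclideanSpace ℂ ι} (hv : v ∈ eigenSpan hA s) :
    reQuadForm A v ≤ t * ‖v‖ ^ 2 := by
  rw [reQuadForm_eq_sum hA, norm_sq_eq_sum_eigenvectorBasis hA, Finset.mul_sum]
  refine Finset.sum_le_sum fun i _ => ?_
  by_cases hi : i ∈ s
  · gcongr; exact hs i hi
  · simp [repr_eq_zero_of_mem_eigenSpan hA hv hi]

/-- The number of eigenvalues of `A` above `t`, with multiplicity. -/
noncomputable def countAbove (hA : A.IsHermitian) (t : ℝ) : ℕ :=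
  (Finset.univ.filter fun i => t < hA.eigenvalues i).card

lemma finrank_le_countAbove (hA : A.IsHermitian) (t : ℝ)
    (W : Submodule ℂ (EuclideanSpace ℂ ι))
    (hW : ∀ v ∈ W, v ≠ 0 → t * ‖v‖ ^ 2 < reQuadForm A v) :
    Module.finrank ℂ W ≤ countAbove hA t := by
  have hdisj : Disjoint W (eigenSpan hA (Finset.univ.filter fun i => ¬ t < hA.eigenvalues i)) := by
    rw [Submodule.disjoint_def]
    intro v hv hv'
    by_contra h0
    exact (hW v hv h0).not_ge (reQuadForm_le_mul_norm_sq hA (by simp) hv')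
  have h := Submodule.finrank_add_finrank_le_of_disjoint hdisj
  rw [finrank_eigenSpan, finrank_euclideanSpace, ← Finset.card_univ,
    ← Finset.card_filter_add_card_filter_not (s := Finset.univ) fun i => t < hA.eigenvalues i] at h
  exact Nat.le_of_add_le_add_right h

lemma card_le_countAbove_add (hA : A.IsHermitian) (hB : B.IsHermitian) (s : Finset ι) (t : ℝ)
    (C : Matrix ι ι ℂ)
    (h : ∀ v ∈ eigenSpan hA s, v ≠ 0 → Matrix.toEuclideanLin C v = 0 →
      t * ‖v‖ ^ 2 < reQuadForm B v) :
    s.card ≤ countAbove hB t + C.rank := by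
  have h₁ := finrank_le_countAbove hB t
    (eigenSpan hA s ⊓ LinearMap.ker (Matrix.toEuclideanLin C)) fun v hv h0 => h v hv.1 h0 hv.2
  have h₂ := Submodule.finrank_sup_add_finrank_inf_eq (eigenSpan hA s)
    (LinearMap.ker (Matrix.toEuclideanLin C))
  have h₃ := (Matrix.toEuclideanLin C).finrank_range_add_finrank_ker
  have h₄ : C.rank = Module.finrank ℂ (LinearMap.range (Matrix.toEuclideanLin C)) := by
    rw [Matrix.toEuclideanLin_eq_toLin_orthonormal]
    exact C.rank_eq_finrank_range_toLin _ _
  have h₅ := (eigenSpan hA s ⊔ LinearMap.ker (Matrix.toEuclideanLin C)).finrank_le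
  rw [finrank_eigenSpan] at h₂
  omega

lemma card_le_countAbove (hA : A.IsHermitian) (hB : B.IsHermitian) (s : Finset ι) (t : ℝ)
    (h : ∀ v ∈ eigenSpan hA s, v ≠ 0 → t * ‖v‖ ^ 2 < reQuadForm B v) :
    s.card ≤ countAbove hB t := by
  simpa using card_le_countAbove_add hA hB s t 0 fun v hv h0 _ => h v hv h0

lemma exists_gap (hA : A.IsHermitian) (t : ℝ) : ∃ t', t < t' ∧
    ∀ i ∈ Finset.univ.filter fun i => t < hA.eigenvalues i, t' ≤ hA.eigenvalues i := by
  set s := Finset.univ.filter fun i => t < hA.eigenvalues i with hs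
  rcases s.eq_empty_or_nonempty with h | h
  · exact ⟨t + 1, by linarith, by simp [h]⟩
  · refine ⟨s.inf' h hA.eigenvalues, ?_, fun i hi => Finset.inf'_le _ hi⟩
    rw [Finset.lt_inf'_iff]
    exact fun i hi => (Finset.mem_filter.mp hi).2

lemma lt_reQuadForm_of_mem_eigenSpan (hA : A.IsHermitian) {t : ℝ} {v : EuclideanSpace ℂ ι}
    (hv : v ∈ eigenSpan hA (Finset.univ.filter fun i => t < hA.eigenvalues i)) (h0 : v ≠ 0) :
    t * ‖v‖ ^ 2 < reQuadForm A v := by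
  obtain ⟨t', ht, ht'⟩ := exists_gap hA t
  have : 0 < ‖v‖ ^ 2 := by positivity
  exact (mul_lt_mul_of_pos_right ht this).trans_le (mul_norm_sq_le_reQuadForm hA ht' hv)

lemma countAbove_mono (hA : A.IsHermitian) (hB : B.IsHermitian) (t : ℝ)
    (h : ∀ v, reQuadForm A v ≤ reQuadForm B v) : countAbove hA t ≤ countAbove hB t :=
  card_le_countAbove hA hB _ t fun v hv h0 =>
    (lt_reQuadForm_of_mem_eigenSpan hA hv h0).trans_le (h v)

lemma countAbove_add_smul_le (hA : A.IsHermitian) (t r : ℝ) (C : Matrix ι ι ℂ)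
    (hB : (A + r • C).IsHermitian) :
    countAbove hB t ≤ countAbove hA t + C.rank := by
  refine card_le_countAbove_add hB hA _ t C fun v hv h0 hC => ?_
  have := lt_reQuadForm_of_mem_eigenSpan hB hv h0
  rwa [reQuadForm_add, reQuadForm_smul, show reQuadForm C v = 0 by simp [reQuadForm, hC], mul_zero,
    add_zero] at this

lemma lowerSemicontinuous_countAbove {X : Type*} [TopologicalSpace X] {H : X → Matrix ι ι ℂ}
    (hH : ∀ x, (H x).IsHermitian) (hc : Continuous H) (t : ℝ) :
    LowerSemicontinuous fun x => countAbove (hH x) t := by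
  intro x k hk
  obtain ⟨t', ht, ht'⟩ := exists_gap (hH x) t
  have hcont : Continuous fun y =>
      ‖Matrix.toEuclideanCLM (n := ι) (𝕜 := ℂ) (H y - H x)‖ := by
    have : Continuous (Matrix.toEuclideanCLM (n := ι) (𝕜 := ℂ)) :=
      LinearMap.continuous_of_finiteDimensional
        (Matrix.toEuclideanCLM (n := ι) (𝕜 := ℂ)).toAlgEquiv.toLinearMap
    exact (this.comp (hc.sub continuous_const)).norm
  have hev := hcont.continuousAt.eventually_lt (continuousAt_const (x := x) (y := t' - t))
    (by simpa using ht)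
  filter_upwards [hev] with y hy
  refine hk.trans_le (card_le_countAbove (hH x) (hH y) _ t fun v hv h0 => ?_)
  have h₁ := mul_norm_sq_le_reQuadForm (hH x) ht' hv
  have h₂ := abs_le.mp (abs_reQuadForm_le (H y - H x) v)
  rw [reQuadForm_sub] at h₂
  have h₃ : 0 < ‖v‖ ^ 2 := by positivity
  nlinarith [mul_lt_mul_of_pos_right hy h₃]

end QuadraticForm

section Averaging

open scoped ENNReal

lemma lintegral_tsub_shift_le (μ : Measure ℝ) {f : ℝ → ℕ} (hf : Monotone f) {r : ℕ}
    (hr : ∀ x y, f y ≤ f x + r) (c : ℝ) {S : ℝ≥0∞}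
    (hS : ∀ l, μ (Set.Icc (l - c) (l + c)) ≤ S) :
    ∫⁻ x, ((f (x + c) - f x : ℕ) : ℝ≥0∞) ∂μ ≤ r * S := by
  obtain ⟨x₀, hx₀⟩ : ∃ x₀, ∀ x, f x₀ ≤ f x :=
    ⟨Function.argmin f, fun x => Function.argmin_le f x⟩
  have hm : Measurable f := hf.measurable
  have hset (j : ℕ) : MeasurableSet {x | f x ≤ j ∧ j < f (x + c)} :=
    (measurableSet_le hm measurable_const).inter
      (measurableSet_lt measurable_const (hm.comp (measurable_id.add_const c)))
  have hcount (x : ℝ) : ((f (x + c) - f x : ℕ) : ℝ≥0∞) =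
      ∑ j ∈ Finset.Ico (f x₀) (f x₀ + r),
        {x | f x ≤ j ∧ j < f (x + c)}.indicator (fun _ => (1 : ℝ≥0∞)) x := by
    simp only [Set.indicator_apply, Set.mem_ofPred_eq, Finset.sum_boole]
    rw [← Nat.card_Ico]
    congr 2
    ext j
    have := hx₀ x
    have := hr x₀ (x + c)
    simp only [Finset.mem_Ico, Finset.mem_filter]
    omega
  have hbound (j : ℕ) : μ {x | f x ≤ j ∧ j < f (x + c)} ≤ S := by
    rcases Set.eq_empty_or_nonempty {x | f x ≤ j ∧ j < f (x + c)} with h | ⟨x, hx⟩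
    · simp [h]
    · refine (measure_mono fun y hy => ?_).trans (hS x)
      have h₁ : y < x + c := hf.reflect_lt (hy.1.trans_lt hx.2)
      have h₂ : x < y + c := hf.reflect_lt (hx.1.trans_lt hy.2)
      exact ⟨by linarith, h₁.le⟩
  simp only [hcount]
  rw [lintegral_finsetSum _ fun j _ => measurable_const.indicator (hset j)]
  calc _ ≤ ∑ j ∈ Finset.Ico (f x₀) (f x₀ + r), S :=
        Finset.sum_le_sum fun j _ => by
          rw [lintegral_indicator_const (hset j), one_mul]; exact hbound j
    _ = _ := by simp

variable {κ : Type*} [Fintype κ] [DecidableEq κ]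

lemma lintegral_pi_le_of_update (μ : Measure ℝ) [IsProbabilityMeasure μ] (m : κ)
    {g : (κ → ℝ) → ℝ≥0∞} (hg : Measurable g) {R : ℝ≥0∞}
    (h : ∀ ω, ∫⁻ x, g (Function.update ω m x) ∂μ ≤ R) :
    ∫⁻ ω, g ω ∂(Measure.pi fun _ => μ) ≤ R := by
  calc ∫⁻ ω, g ω ∂(Measure.pi fun _ => μ) ≤ ∫⁻ _, R ∂(Measure.pi fun _ : κ => μ) := by
        refine lintegral_le_of_lmarginal_le {m} hg measurable_const fun ω => ?_
        simpa [lmarginal_singleton] using h ω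
    _ = R := by simp

lemma lintegral_tsub_shift_pi_le (μ : Measure ℝ) [IsProbabilityMeasure μ] {F : (κ → ℝ) → ℕ}
    (hm : Measurable F) (hF : Monotone F) {r : κ → ℕ}
    (hr : ∀ ω m x, F (Function.update ω m x) ≤ F ω + r m) (c : ℝ) {S : ℝ≥0∞}
    (hS : ∀ l, μ (Set.Icc (l - c) (l + c)) ≤ S) (s : Finset κ) :
    ∫⁻ ω, ((F (ω + fun k => if k ∈ s then c else 0) - F ω : ℕ) : ℝ≥0∞)
      ∂(Measure.pi fun _ => μ) ≤ (∑ m ∈ s, (r m : ℝ≥0∞)) * S := by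
  induction s using Finset.induction_on with
  | empty =>
    have h (ω : κ → ℝ) : (ω + fun k => if k ∈ (∅ : Finset κ) then c else 0) = ω := by
      ext; simp
    simp only [h, tsub_self]
    simp
  | insert m s hms ih =>
    set a : κ → ℝ := fun k => if k ∈ s then c else 0
    set b : κ → ℝ := fun k => if k ∈ insert m s then c else 0
    have hma (v : κ → ℝ) : Measurable fun ω => F (ω + v) := hm.comp (measurable_id.add_const v)
    have hmab : Measurable fun ω => ((F (ω + b) - F (ω + a) : ℕ) : ℝ≥0∞) :=
      measurable_from_top.comp ((hma b).sub (hma a))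
    have hstep : ∫⁻ ω, ((F (ω + b) - F (ω + a) : ℕ) : ℝ≥0∞) ∂(Measure.pi fun _ => μ) ≤
        r m * S := by
      refine lintegral_pi_le_of_update μ m hmab fun ω => ?_
      have ha (x : ℝ) : Function.update ω m x + a = Function.update (ω + a) m x := by
        ext k
        rcases eq_or_ne k m with rfl | hk
        · simp [a, hms]
        · simp [hk]
      have hb (x : ℝ) : Function.update ω m x + b = Function.update (ω + a) m (x + c) := by
        ext k
        rcases eq_or_ne k m with rfl | hk
        · simp [b]
        · simp [hk, a, b]
      simp only [ha, hb]
      refine lintegral_tsub_shift_le μ (f := fun x => F (Function.update (ω + a) m x))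
        (fun x y hxy => hF (Function.update_mono hxy)) (fun x y => ?_) c hS
      simpa using hr (Function.update (ω + a) m x) m y
    rw [Finset.sum_insert hms, add_mul]
    refine le_trans ?_ (add_le_add hstep ih)
    rw [← lintegral_add_left hmab]
    refine lintegral_mono fun ω => ?_
    rw [← Nat.cast_add]
    exact Nat.cast_le.mpr tsub_le_tsub_add_tsub

end Averaging

lemma modulusOfContinuity_nonneg (μ : Measure ℝ) (δ : ℝ) : 0 ≤ modulusOfContinuity μ δ :=
  Real.iSup_nonneg fun _ => ENNReal.toReal_nonneg

lemma measure_Icc_le_modulusOfContinuity (μ : Measure ℝ) [IsProbabilityMeasure μ] (δ l : ℝ) :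
    μ (Set.Icc (l - δ) (l + δ)) ≤ ENNReal.ofReal (modulusOfContinuity μ δ) := by
  rw [ENNReal.le_ofReal_iff_toReal_le (measure_ne_top _ _) (modulusOfContinuity_nonneg μ δ)]
  refine le_ciSup (f := fun l => (μ (Set.Icc (l - δ) (l + δ))).toReal) ⟨1, ?_⟩ l
  rintro _ ⟨x, rfl⟩
  exact measureReal_le_one

lemma reQuadForm_alloy {n L : ℕ} (A₀ : Matrix (Fin n) (Fin n) ℂ)
    (u : Fin L → Matrix (Fin n) (Fin n) ℂ) (ω : Fin L → ℝ) (v : EuclideanSpace ℂ (Fin n)) :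
    reQuadForm (A₀ + ∑ m, ω m • u m) v = reQuadForm A₀ v + ∑ m, ω m * reQuadForm (u m) v := by
  simp only [reQuadForm_add, reQuadForm_sum, reQuadForm_smul]

/-- Wegner estimate for alloy-type random Hermitian matrices: if the nonnegative single
site potentials `uₘ` satisfy the covering condition `∑ₘ uₘ ≥ 1` and the i.i.d. coupling
constants `ωₘ` have compactly supported distribution `μ`, then the expected number of
eigenvalues of `H(ω) = A₀ + ∑ₘ ωₘ uₘ` in `[λ-ε, λ+ε]` is at most
`s(μ, 4ε) · ∑ₘ rank uₘ`. -/
theorem wegner_estimate {n L : ℕ} (A₀ : Matrix (Fin n) (Fin n) ℂ) (hA₀ : A₀.IsHermitian)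
    (u : Fin L → Matrix (Fin n) (Fin n) ℂ) (hu : ∀ m, (u m).PosSemidef)
    (hcov : (∑ m, u m - 1).PosSemidef)
    (μ : Measure ℝ) [IsProbabilityMeasure μ]
    (K : Set ℝ) (hK : IsCompact K) (hμK : μ Kᶜ = 0)
    (lam ε : ℝ) (hε : 0 < ε) :
    ∫ ω : Fin L → ℝ,
        ((Finset.univ.filter (fun i =>
          lam - ε ≤ (isHermitian_alloy hA₀ (fun m => (hu m).isHermitian) ω).eigenvalues i ∧
          (isHermitian_alloy hA₀ (fun m => (hu m).isHermitian) ω).eigenvalues i ≤ lam + ε)).card : ℝ)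
      ∂(Measure.pi fun _ : Fin L => μ) ≤
      modulusOfContinuity μ (4 * ε) * ∑ m, ((u m).rank : ℝ) := by
  set H : (Fin L → ℝ) → Matrix (Fin n) (Fin n) ℂ := fun ω => A₀ + ∑ m, ω m • u m
  have hH (ω : Fin L → ℝ) : (H ω).IsHermitian :=
    isHermitian_alloy hA₀ (fun m => (hu m).isHermitian) ω
  set F : (Fin L → ℝ) → ℕ := fun ω => countAbove (hH ω) (lam + ε)
  have hF : Monotone F := fun ω ω' h => countAbove_mono _ _ _ fun v => by
    simp only [H, reQuadForm_alloy]
    gcongr with m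
    · exact (hu m).reQuadForm_nonneg v
    · exact h m
  have hm : Measurable F :=
    (lowerSemicontinuous_countAbove hH (by fun_prop) (lam + ε)).measurable
  have hr (ω : Fin L → ℝ) (m : Fin L) (x : ℝ) :
      F (Function.update ω m x) ≤ F ω + (u m).rank := by
    have h : H (Function.update ω m x) = H ω + (x - ω m) • u m := by
      simp only [H, ← Finset.add_sum_erase _ _ (Finset.mem_univ m), Function.update_self, sub_smul]
      rw [Finset.sum_congr rfl fun k hk => by
        rw [Function.update_of_ne (Finset.ne_of_mem_erase hk)]]
      abel
    have h' := countAbove_add_smul_le (hH ω) (lam + ε) (x - ω m) (u m) (h ▸ hH _)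
    simp only [F, h]
    exact h'
  have hcount (ω : Fin L → ℝ) : (Finset.univ.filter fun i =>
      lam - ε ≤ (hH ω).eigenvalues i ∧ (hH ω).eigenvalues i ≤ lam + ε).card ≤
      F (ω + fun k => if k ∈ Finset.univ then 4 * ε else 0) - F ω := by
    have h₁ : (Finset.univ.filter fun i => lam - ε ≤ (hH ω).eigenvalues i).card ≤
        F (ω + fun k => if k ∈ Finset.univ then 4 * ε else 0) := by
      refine card_le_countAbove (hH ω) _ _ _ fun v hv h0 => ?_
      have h := mul_norm_sq_le_reQuadForm (hH ω) (t := lam - ε) (by simp) hv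
      have hc := hcov.reQuadForm_nonneg v
      rw [reQuadForm_sub, reQuadForm_sum, reQuadForm_one] at hc
      have h₀ : 0 < ‖v‖ ^ 2 := by positivity
      simp only [H, reQuadForm_alloy, Pi.add_apply, Finset.mem_univ, if_true, add_mul,
        Finset.sum_add_distrib, ← Finset.mul_sum] at h ⊢
      nlinarith [mul_pos hε h₀, mul_nonneg hε.le hc]
    have h₂ := Finset.card_filter_add_card_filter_not
      (s := Finset.univ.filter fun i => lam - ε ≤ (hH ω).eigenvalues i)
      (fun i => (hH ω).eigenvalues i ≤ lam + ε)
    rw [Finset.filter_filter, Finset.filter_filter] at h₂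
    have h₃ : (Finset.univ.filter fun i => lam - ε ≤ (hH ω).eigenvalues i ∧
        ¬ (hH ω).eigenvalues i ≤ lam + ε).card = F ω := by
      refine congrArg Finset.card (Finset.filter_congr fun i _ => ?_)
      rw [not_le]
      exact ⟨fun h => h.2, fun h => ⟨by linarith, h⟩⟩
    omega
  have hmod : 0 ≤ modulusOfContinuity μ (4 * ε) := modulusOfContinuity_nonneg μ _
  have key := lintegral_tsub_shift_pi_le μ hm hF hr (4 * ε)
    (measure_Icc_le_modulusOfContinuity μ (4 * ε)) Finset.univ
  rw [← Nat.cast_sum, ← ENNReal.ofReal_natCast, ← ENNReal.ofReal_mul (Nat.cast_nonneg _),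
    mul_comm (Nat.cast _), Nat.cast_sum] at key
  rw [← ENNReal.ofReal_le_ofReal_iff (by positivity)]
  refine (Real.ofReal_le_enorm _).trans ((enorm_integral_le_lintegral_enorm _).trans
    ((lintegral_mono fun ω => ?_).trans key))
  rw [Real.enorm_of_nonneg (Nat.cast_nonneg _), ENNReal.ofReal_natCast]
  exact Nat.cast_le.mpr (hcount ω)
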